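/- arXiv:1510.03605 — 3 statements merged into one kernel-verified Lean document; each statement's English description precedes it below -/
import Mathlib

section
/- Assume C ≠ ∅. Then the following are equivalent: (a) Γ is a regular graph (all vertices have the same degree); (b) [G:H] = 2 and H∩C = ∅; (c) Γ coincides with the (ordinary) Cayley graph Cay(G,C), i.e., for all distinct x,y ∈ G, x and y are adjacent in Γ if and only if x⁻¹y ∈ C. -/
open scoped Pointwise

/-- The relative Cayley graph `Cay(G, H, C)`: vertices are the elements of `G`, and distinct
vertices `x`, `y` are adjacent iff (`x ∈ H` or `y ∈ H`) and `x⁻¹ * y ∈ C`, where `C` is an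
inverse-closed subset of `G \ {1}`. -/
def relCayley {G : Type*} [Group G] (H : Subgroup G) (C : Set G)
    (hC : ∀ c ∈ C, c⁻¹ ∈ C) : SimpleGraph G where
  Adj x y := x ≠ y ∧ (x ∈ H ∨ y ∈ H) ∧ x⁻¹ * y ∈ C
  symm := by
    refine ⟨?_⟩
    rintro x y ⟨h1, h2, h3⟩
    exact ⟨h1.symm, h2.symm, by simpa using hC _ h3⟩
  loopless := ⟨fun x h => h.1 rfl⟩


theorem relCayley_neighborSet_subset {G : Type*} [Group G] (H : Subgroup G) (C : Set G)
    (hC : ∀ c ∈ C, c⁻¹ ∈ C) (x : G) : (relCayley H C hC).neighborSet x ⊆ x • C := by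
  rintro y ⟨-, -, h⟩
  exact Set.mem_smul_set_iff_inv_smul_mem.2 h

theorem relCayley_neighborSet_one {G : Type*} [Group G] (H : Subgroup G) {C : Set G}
    (h1 : (1 : G) ∉ C) (hC : ∀ c ∈ C, c⁻¹ ∈ C) : (relCayley H C hC).neighborSet 1 = C := by
  ext y
  refine ⟨fun h => by simpa using h.2.2, fun h => ⟨?_, Or.inl H.one_mem, by simpa using h⟩⟩
  rintro rfl
  exact h1 h

/-- The relative Cayley graph is the ordinary Cayley graph iff each neighbourhood is a
translate of the connection set. -/
theorem relCayley_adj_iff_iff_neighborSet_eq {G : Type*} [Group G] (H : Subgroup G) {C : Set G}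
    (h1 : (1 : G) ∉ C) (hC : ∀ c ∈ C, c⁻¹ ∈ C) :
    (∀ x y : G, x ≠ y → ((relCayley H C hC).Adj x y ↔ x⁻¹ * y ∈ C)) ↔
      ∀ x : G, (relCayley H C hC).neighborSet x = x • C := by
  refine ⟨fun h x => (relCayley_neighborSet_subset H C hC x).antisymm fun y hy => ?_,
    fun h x y _ => ?_⟩
  · rw [Set.mem_smul_set_iff_inv_smul_mem, smul_eq_mul] at hy
    refine (h x y ?_).2 hy
    rintro rfl
    exact h1 (by simpa using hy)
  · rw [← SimpleGraph.mem_neighborSet, h x, Set.mem_smul_set_iff_inv_smul_mem, smul_eq_mul]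

theorem relCayley_regular_iff_neighborSet_eq {G : Type*} [Group G] [Finite G] (H : Subgroup G)
    {C : Set G} (h1 : (1 : G) ∉ C) (hC : ∀ c ∈ C, c⁻¹ ∈ C) :
    (∃ d : ℕ, ∀ x : G, ((relCayley H C hC).neighborSet x).ncard = d) ↔
      ∀ x : G, (relCayley H C hC).neighborSet x = x • C := by
  refine ⟨?_, fun h => ⟨C.ncard, fun x => by rw [h x, Set.ncard_smul_set]⟩⟩
  rintro ⟨d, hd⟩ x
  refine Set.eq_of_subset_of_ncard_le (relCayley_neighborSet_subset H C hC x) ?_ (Set.toFinite _)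
  rw [Set.ncard_smul_set, hd x, ← hd 1, relCayley_neighborSet_one H h1 hC]

theorem index_two_and_disjoint_iff_relCayley_adj_iff {G : Type*} [Group G] {H : Subgroup G}
    (hH : H ≠ ⊤) {C : Set G} (h1 : (1 : G) ∉ C) (hC : ∀ c ∈ C, c⁻¹ ∈ C) (hne : C.Nonempty) :
    (H.index = 2 ∧ (H : Set G) ∩ C = ∅) ↔
      ∀ x y : G, x ≠ y → ((relCayley H C hC).Adj x y ↔ x⁻¹ * y ∈ C) := by
  constructor
  · rintro ⟨hi, hd⟩ x y hxy
    refine ⟨fun h => h.2.2, fun h => ⟨hxy, ?_, h⟩⟩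
    by_contra! hn
    have hmem : x⁻¹ * y ∈ H := by
      rw [Subgroup.mul_mem_iff_of_index_two hi, inv_mem_iff]
      exact iff_of_false hn.1 hn.2
    exact (Set.ext_iff.1 hd _).1 ⟨hmem, h⟩
  · intro h
    have hmul : ∀ x ∉ H, ∀ c ∈ C, x * c ∈ H := by
      intro x hx c hc
      have hne : x ≠ x * c := fun he => h1 (left_eq_mul.1 he ▸ hc)
      exact (((h x (x * c) hne).2 (by simpa using hc)).2.1).resolve_left hx
    obtain ⟨x, hx⟩ : ∃ x, x ∉ H := by
      by_contra! hall
      exact hH ((Subgroup.eq_top_iff' H).2 hall)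
    have hdisj : ∀ c ∈ C, c ∉ H := fun c hc hcH =>
      hx ((H.mul_mem_cancel_right hcH).1 (hmul x hx c hc))
    obtain ⟨c, hc⟩ := hne
    refine ⟨Subgroup.index_eq_two_iff.2 ⟨c, fun b => ?_⟩, ?_⟩
    · by_cases hb : b ∈ H
      · exact Or.inr ⟨hb, fun hbc => hdisj c hc ((H.mul_mem_cancel_left hb).1 hbc)⟩
      · exact Or.inl ⟨hmul b hb c hc, hb⟩
    · exact Set.eq_empty_of_forall_notMem fun y hy => hdisj y hy.2 hy.1

/-- Theorem 2.6: for nonempty `C`, the relative Cayley graph `Γ = Cay(G,H,C)` is regular iff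
`[G:H] = 2` and `H ∩ C = ∅`, iff `Γ` is the ordinary Cayley graph `Cay(G,C)`. -/
theorem statement3 {G : Type*} [Group G] [Finite G] (H : Subgroup G) (hH : H ≠ ⊤)
    (C : Set G) (h1 : (1 : G) ∉ C) (hC : ∀ c ∈ C, c⁻¹ ∈ C) (hne : C.Nonempty) :
    ((∃ d : ℕ, ∀ x : G, ((relCayley H C hC).neighborSet x).ncard = d) ↔
      (H.index = 2 ∧ (H : Set G) ∩ C = ∅)) ∧
    ((H.index = 2 ∧ (H : Set G) ∩ C = ∅) ↔
      (∀ x y : G, x ≠ y → ((relCayley H C hC).Adj x y ↔ x⁻¹ * y ∈ C))) := by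
  have hbc := index_two_and_disjoint_iff_relCayley_adj_iff hH h1 hC hne
  exact ⟨(relCayley_regular_iff_neighborSet_eq H h1 hC).trans
    ((relCayley_adj_iff_iff_neighborSet_eq H h1 hC).symm.trans hbc.symm), hbc⟩
end

section
/- (i) ω(Γ) ≥ ψ(H∩C); moreover ω(Γ) ≥ ψ(H∩C) + 1 if there exist c ∈ C∖H and a subgroup K of G with K ⊆ (H∩C) ∪ {1}, |K| = ψ(H∩C), and K ⊆ cC. (ii) If C·C·C ⊆ C, then ω(Γ) ≤ ψ(H∩C) + 1. -/
open scoped Pointwise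

/-- `ψ(X)` is the maximum order of a subgroup of `G` contained in `X ∪ {1}`. -/
noncomputable def psi {G : Type*} [Group G] (X : Set G) : ℕ :=
  sSup {n | ∃ K : Subgroup G, (K : Set G) ⊆ insert (1 : G) X ∧ Nat.card K = n}

section psi

variable {G : Type*} [Group G] [Finite G] (X : Set G)

lemma bddAbove_card_subgroup_subset :
    BddAbove {n | ∃ K : Subgroup G, (K : Set G) ⊆ insert (1 : G) X ∧ Nat.card K = n} := by
  refine ⟨Nat.card G, ?_⟩
  rintro n ⟨K, -, rfl⟩
  exact Subgroup.card_le_card_group K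

lemma exists_subgroup_card_eq_psi :
    ∃ K : Subgroup G, (K : Set G) ⊆ insert (1 : G) X ∧ Nat.card K = psi X :=
  Nat.sSup_mem (s := {n | ∃ K : Subgroup G, (K : Set G) ⊆ insert (1 : G) X ∧ Nat.card K = n})
    ⟨1, ⊥, by simp, by simp⟩ (bddAbove_card_subgroup_subset X)

lemma one_le_psi : 1 ≤ psi X :=
  le_csSup (bddAbove_card_subgroup_subset X) ⟨⊥, by simp, by simp⟩

end psi

lemma ncard_le_cliqueNum {V : Type*} [Finite V] {s : Set V} {Γ : SimpleGraph V} (hs : Γ.IsClique s) :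
    s.ncard ≤ Γ.cliqueNum := by
  rw [Set.ncard_eq_toFinset_card s]
  exact SimpleGraph.IsClique.card_le_cliqueNum (tc := by simpa using hs)

section relCayley

variable {G : Type*} [Group G] {H : Subgroup G} {C : Set G} {hC : ∀ c ∈ C, c⁻¹ ∈ C}

lemma isClique_relCayley_subgroup {K : Subgroup G}
    (hK : (K : Set G) ⊆ insert (1 : G) ((H : Set G) ∩ C)) :
    (relCayley H C hC).IsClique (K : Set G) := by
  intro x hx y hy hxy
  refine ⟨hxy, Or.inl ?_, ?_⟩
  · rcases hK hx with rfl | h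
    · exact H.one_mem
    · exact h.1
  · rcases hK (K.mul_mem (K.inv_mem hx) hy) with h | h
    · exact absurd (inv_mul_eq_one.mp h) hxy
    · exact h.2

/-- If `C³ ⊆ C`, a triangle would force `1 ∈ C`. -/
lemma cliqueNum_relCayley_le_two (h1 : (1 : G) ∉ C) (h3 : C * C * C ⊆ C) :
    (relCayley H C hC).cliqueNum ≤ 2 := by
  obtain ⟨s, hs, hcard⟩ := (relCayley H C hC).exists_isNClique_cliqueNum
  rw [← hcard]
  by_contra! hlt
  obtain ⟨a, ha, b, hb, c, hc, hab, hac, hbc⟩ := Finset.two_lt_card.mp hlt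
  have key := h3 (Set.mul_mem_mul (Set.mul_mem_mul (hs ha hb hab).2.2 (hs hb hc hbc).2.2)
    (hs hc ha hac.symm).2.2)
  exact h1 (by simpa [mul_assoc] using key)

end relCayley

/-- Theorem 4.4: (i) `ω(Γ) ≥ ψ(H ∩ C)`, and `ω(Γ) ≥ ψ(H ∩ C) + 1` whenever some subgroup `K`
of `G` contained in `(H ∩ C) ∪ {1}` with `|K| = ψ(H ∩ C)` satisfies `K ⊆ cC` for some
`c ∈ C \ H`; (ii) if `C³ ⊆ C`, then `ω(Γ) ≤ ψ(H ∩ C) + 1`. -/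
theorem statement12 {G : Type*} [Group G] [Finite G] (H : Subgroup G) (hH : H ≠ ⊤)
    (C : Set G) (h1 : (1 : G) ∉ C) (hC : ∀ c ∈ C, c⁻¹ ∈ C) :
    (psi ((H : Set G) ∩ C) ≤ (relCayley H C hC).cliqueNum ∧
      ((∃ c ∈ C, c ∉ H ∧ ∃ K : Subgroup G,
          (K : Set G) ⊆ insert (1 : G) ((H : Set G) ∩ C) ∧
          Nat.card K = psi ((H : Set G) ∩ C) ∧ (K : Set G) ⊆ c • C) →
        psi ((H : Set G) ∩ C) + 1 ≤ (relCayley H C hC).cliqueNum)) ∧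
    (C * C * C ⊆ C → (relCayley H C hC).cliqueNum ≤ psi ((H : Set G) ∩ C) + 1) := by
  refine ⟨⟨?_, ?_⟩, fun h3 => ?_⟩
  · obtain ⟨K, hK, hcard⟩ := exists_subgroup_card_eq_psi ((H : Set G) ∩ C)
    rw [← hcard]
    exact ncard_le_cliqueNum (isClique_relCayley_subgroup hK)
  · rintro ⟨c, -, hcH, K, hK, hcard, hKc⟩
    have hKH : K ≤ H := by
      intro x hx
      rcases hK hx with rfl | h
      · exact H.one_mem
      · exact h.1
    have hcK : c ∉ (K : Set G) := fun h => hcH (hKH h)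
    rw [← hcard, ← SetLike.coe_sort_coe, Nat.card_coe_set_eq, ← Set.ncard_insert_of_notMem hcK]
    refine ncard_le_cliqueNum ((isClique_relCayley_subgroup hK).insert fun k hk hck => ?_)
    exact ⟨hck, Or.inr (hKH hk), by simpa using Set.mem_smul_set_iff_inv_smul_mem.mp (hKc hk)⟩
  · have := one_le_psi ((H : Set G) ∩ C)
    have := cliqueNum_relCayley_le_two (H := H) (hC := hC) h1 h3
    lia
end

section
/- Γ is triangle-free (contains no three pairwise adjacent vertices) if and only if H ∩ C ∩ C² = ∅. -/
open scoped Pointwise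

/-- Two adjacent vertices lying in `H` with a common neighbour yield an element of
`H ∩ C ∩ C²`. -/
theorem inv_mul_mem_inter_of_common_neighbor {G : Type*} [Group G] {H : Subgroup G} {C : Set G}
    {x y z : G} (hx : x ∈ H) (hy : y ∈ H) (hxy : x⁻¹ * y ∈ C) (hxz : x⁻¹ * z ∈ C)
    (hzy : z⁻¹ * y ∈ C) : x⁻¹ * y ∈ (H : Set G) ∩ C ∩ (C * C) :=
  ⟨⟨H.mul_mem (H.inv_mem hx) hy, hxy⟩, Set.mem_mul.2 ⟨_, hxz, _, hzy, by group⟩⟩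

/-- Lemma 5.4: `Γ = Cay(G,H,C)` is triangle-free iff `H ∩ C ∩ C² = ∅`. -/
theorem statement18 {G : Type*} [Group G] [Finite G] (H : Subgroup G) (hH : H ≠ ⊤)
    (C : Set G) (h1 : (1 : G) ∉ C) (hC : ∀ c ∈ C, c⁻¹ ∈ C) :
    (relCayley H C hC).CliqueFree 3 ↔ (H : Set G) ∩ C ∩ (C * C) = ∅ := by
  classical
  constructor
  · intro hfree
    rw [Set.eq_empty_iff_forall_notMem]
    rintro _ ⟨⟨hH', hab⟩, a, ha, b, hb, rfl⟩
    refine hfree {1, a, a * b} (SimpleGraph.is3Clique_triple_iff.2 ⟨?_, ?_, ?_⟩)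
    · exact ⟨fun h => h1 (h ▸ ha), Or.inl H.one_mem, by simpa using ha⟩
    · exact ⟨fun h => h1 (h ▸ hab), Or.inl H.one_mem, by simpa using hab⟩
    · refine ⟨fun h => h1 ?_, Or.inr hH', by simpa using hb⟩
      rwa [← left_eq_mul.1 h]
  · intro hempty s hs
    obtain ⟨x, y, z, hxy, hxz, hyz, -⟩ := SimpleGraph.is3Clique_iff.1 hs
    have key : ∀ {x y z : G}, (relCayley H C hC).Adj x y → (relCayley H C hC).Adj x z →
        (relCayley H C hC).Adj y z → x ∈ H → y ∈ H → False := fun hxy hxz hyz hx hy =>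
      Set.eq_empty_iff_forall_notMem.1 hempty _
        (inv_mul_mem_inter_of_common_neighbor hx hy hxy.2.2 hxz.2.2 hyz.symm.2.2)
    rcases hxy.2.1 with hx | hy
    · rcases hyz.2.1 with hy | hz
      · exact key hxy hxz hyz hx hy
      · exact key hxz hxy hyz.symm hx hz
    · rcases hxz.2.1 with hx | hz
      · exact key hxy hxz hyz hx hy
      · exact key hyz hxy.symm hxz.symm hy hz
end
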